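/- arXiv:2202.07243 — 2 statements merged into one kernel-verified Lean document; each statement's English description precedes it below -/
import Mathlib

section
/- Let p be an odd prime. Then the Schur multiplier H²(H₃(ℤ/p²ℤ), ℂˣ) of the Heisenberg group over ℤ/p²ℤ is isomorphic as an abelian group to (ℤ/p²ℤ)². -/
/-- The Heisenberg group `H₃(R)` of 3×3 upper unitriangular matrices over a commutative
ring `R`.  An element is determined by its entries: `b` is the (1,2)-entry, `a` is the
(2,3)-entry and `c` is the (1,3)-entry; multiplication is matrix multiplication. -/
@[ext]
structure Heisenberg (R : Type*) [CommRing R] where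
  a : R
  b : R
  c : R

namespace Heisenberg

variable {R : Type*} [CommRing R]

instance : Mul (Heisenberg R) :=
  ⟨fun x y => ⟨x.a + y.a, x.b + y.b, x.c + y.c + x.b * y.a⟩⟩

instance : One (Heisenberg R) := ⟨⟨0, 0, 0⟩⟩

instance : Inv (Heisenberg R) := ⟨fun x => ⟨-x.a, -x.b, -x.c + x.b * x.a⟩⟩

@[simp] lemma mul_a (x y : Heisenberg R) : (x * y).a = x.a + y.a := rfl
@[simp] lemma mul_b (x y : Heisenberg R) : (x * y).b = x.b + y.b := rfl
@[simp] lemma mul_c (x y : Heisenberg R) : (x * y).c = x.c + y.c + x.b * y.a := rfl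
@[simp] lemma one_a : (1 : Heisenberg R).a = 0 := rfl
@[simp] lemma one_b : (1 : Heisenberg R).b = 0 := rfl
@[simp] lemma one_c : (1 : Heisenberg R).c = 0 := rfl
@[simp] lemma inv_a (x : Heisenberg R) : x⁻¹.a = -x.a := rfl
@[simp] lemma inv_b (x : Heisenberg R) : x⁻¹.b = -x.b := rfl
@[simp] lemma inv_c (x : Heisenberg R) : x⁻¹.c = -x.c + x.b * x.a := rfl

/-- Matrix multiplication of unitriangular matrices makes `H₃(R)` a group. -/
instance : Group (Heisenberg R) where
  mul := (· * ·)
  one := 1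
  inv := (·⁻¹)
  mul_assoc x y z := by ext <;> simp only [mul_a, mul_b, mul_c] <;> ring
  one_mul x := by ext <;> simp only [mul_a, mul_b, mul_c, one_a, one_b, one_c] <;> ring
  mul_one x := by ext <;> simp only [mul_a, mul_b, mul_c, one_a, one_b, one_c] <;> ring
  inv_mul_cancel x := by
    ext <;> simp only [mul_a, mul_b, mul_c, inv_a, inv_b, inv_c, one_a, one_b, one_c] <;> ring

end Heisenberg

section Cocycles

variable {G : Type*} [Group G]

/-- A (normalized) `2`-cocycle of `G` with values in `ℂˣ` (trivial action):
`α(1,1) = 1` and `α(x,y)α(xy,z) = α(x,yz)α(y,z)`. -/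
def IsMul2Cocycle (α : G × G → ℂˣ) : Prop :=
  α (1, 1) = 1 ∧ ∀ x y z : G, α (x, y) * α (x * y, z) = α (x, y * z) * α (y, z)

/-- A (normalized) `2`-coboundary of `G` with values in `ℂˣ`. -/
def IsMul2Coboundary (β : G × G → ℂˣ) : Prop :=
  ∃ f : G → ℂˣ, f 1 = 1 ∧ ∀ x y : G, β (x, y) = f x * f y * (f (x * y))⁻¹

/-- Two `2`-cocycles `α, α'` are cohomologous if they differ by a `2`-coboundary:
`α'(x,y) = f(x)f(y)f(xy)⁻¹α(x,y)` for some `f : G → ℂˣ` with `f 1 = 1`. -/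
def IsCohomologous (α α' : G × G → ℂˣ) : Prop :=
  ∃ f : G → ℂˣ, f 1 = 1 ∧ ∀ x y : G, α' (x, y) = f x * f y * (f (x * y))⁻¹ * α (x, y)

/-- The group of normalized `2`-cocycles of `G` with values in `ℂˣ`. -/
def mul2Cocycles (G : Type*) [Group G] : Subgroup ((G × G) → ℂˣ) where
  carrier := {α | IsMul2Cocycle α}
  one_mem' := ⟨rfl, fun _ _ _ => rfl⟩
  mul_mem' {a b} ha hb := by
    refine ⟨by simp only [Pi.mul_apply, ha.1, hb.1, one_mul], fun x y z => ?_⟩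
    simp only [Pi.mul_apply]
    rw [mul_mul_mul_comm, ha.2 x y z, hb.2 x y z, mul_mul_mul_comm]
  inv_mem' {a} ha := by
    refine ⟨by simp only [Pi.inv_apply, ha.1, inv_one], fun x y z => ?_⟩
    simp only [Pi.inv_apply]
    rw [← mul_inv, ← mul_inv, ha.2 x y z]

/-- The group of `2`-coboundaries of `G` with values in `ℂˣ`. -/
def mul2Coboundaries (G : Type*) [Group G] : Subgroup ((G × G) → ℂˣ) where
  carrier := {β | IsMul2Coboundary β}
  one_mem' := ⟨1, rfl, fun x y => by simp⟩
  mul_mem' {a b} ha hb := by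
    obtain ⟨f, hf1, hf⟩ := ha
    obtain ⟨g, hg1, hg⟩ := hb
    refine ⟨f * g, by simp [hf1, hg1], fun x y => ?_⟩
    simp only [Pi.mul_apply, hf x y, hg x y, mul_inv]
    rw [mul_mul_mul_comm (f x) (g x) (f y) (g y),
      mul_mul_mul_comm (f x * f y) (g x * g y) (f (x * y))⁻¹ (g (x * y))⁻¹]
  inv_mem' {a} ha := by
    obtain ⟨f, hf1, hf⟩ := ha
    refine ⟨f⁻¹, by simp [hf1], fun x y => ?_⟩
    simp only [Pi.inv_apply, hf x y, mul_inv, inv_inv]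

/-- The Schur multiplier `H²(G, ℂˣ)`: the second group cohomology of `G` with
coefficients in `ℂˣ` (trivial action), realized as normalized `2`-cocycles modulo
`2`-coboundaries. -/
abbrev SchurMultiplier (G : Type*) [Group G] :=
  mul2Cocycles G ⧸ (mul2Coboundaries G).subgroupOf (mul2Cocycles G)

end Cocycles

/-- The central extension of `G` by `ℂˣ` attached to a `2`-cocycle. -/
@[ext]
structure CocycleExt {G : Type*} [Group G] (α : mul2Cocycles G) where
  fst : ℂˣ
  snd : G

namespace CocycleExt

variable {G : Type*} [Group G] {α : mul2Cocycles G}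

lemma cocycle_eq (α : mul2Cocycles G) (x y z : G) :
    α.1 (x, y) * α.1 (x * y, z) = α.1 (x, y * z) * α.1 (y, z) := α.2.2 x y z

lemma cocycle_one_left (α : mul2Cocycles G) (g : G) : α.1 (1, g) = 1 := by
  have h := cocycle_eq α 1 1 g
  rw [one_mul, one_mul, α.2.1, one_mul] at h
  exact mul_eq_right.mp h.symm

lemma cocycle_one_right (α : mul2Cocycles G) (g : G) : α.1 (g, 1) = 1 := by
  have h := cocycle_eq α g 1 1
  rw [mul_one, mul_one, α.2.1] at h
  exact mul_left_cancel h

instance : Mul (CocycleExt α) :=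
  ⟨fun x y => ⟨x.fst * y.fst * α.1 (x.snd, y.snd), x.snd * y.snd⟩⟩

instance : One (CocycleExt α) := ⟨⟨1, 1⟩⟩

instance : Inv (CocycleExt α) :=
  ⟨fun x => ⟨x.fst⁻¹ * (α.1 (x.snd⁻¹, x.snd))⁻¹, x.snd⁻¹⟩⟩

@[simp] lemma mul_fst (x y : CocycleExt α) :
    (x * y).fst = x.fst * y.fst * α.1 (x.snd, y.snd) := rfl
@[simp] lemma mul_snd (x y : CocycleExt α) : (x * y).snd = x.snd * y.snd := rfl
@[simp] lemma one_fst : (1 : CocycleExt α).fst = 1 := rfl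
@[simp] lemma one_snd : (1 : CocycleExt α).snd = 1 := rfl
@[simp] lemma inv_fst (x : CocycleExt α) :
    x⁻¹.fst = x.fst⁻¹ * (α.1 (x.snd⁻¹, x.snd))⁻¹ := rfl
@[simp] lemma inv_snd (x : CocycleExt α) : x⁻¹.snd = x.snd⁻¹ := rfl

instance : Group (CocycleExt α) where
  mul := (· * ·)
  one := 1
  inv := (·⁻¹)
  mul_assoc x y z := by
    ext1
    · have h := cocycle_eq α x.snd y.snd z.snd
      calc x.fst * y.fst * α.1 (x.snd, y.snd) * z.fst * α.1 (x.snd * y.snd, z.snd)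
          = x.fst * y.fst * z.fst * (α.1 (x.snd, y.snd) * α.1 (x.snd * y.snd, z.snd)) := by
            ac_rfl
        _ = x.fst * (y.fst * z.fst * α.1 (y.snd, z.snd)) * α.1 (x.snd, y.snd * z.snd) := by
            rw [h]; ac_rfl
    · exact mul_assoc _ _ _
  one_mul x := by ext1 <;> simp [cocycle_one_left]
  mul_one x := by ext1 <;> simp [cocycle_one_right]
  inv_mul_cancel x := by
    ext1
    · simp [mul_right_comm]
    · simp

/-- The inclusion of `ℂˣ` in the extension. -/
def incl (α : mul2Cocycles G) : ℂˣ →* CocycleExt α where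
  toFun u := ⟨u, 1⟩
  map_one' := rfl
  map_mul' u v := by ext1 <;> simp [cocycle_one_left]

/-- The projection of the extension onto `G`. -/
def proj (α : mul2Cocycles G) : CocycleExt α →* G where
  toFun x := x.snd
  map_one' := rfl
  map_mul' _ _ := rfl

@[simp] lemma incl_fst (u : ℂˣ) : (incl α u).fst = u := rfl
@[simp] lemma incl_snd (u : ℂˣ) : (incl α u).snd = 1 := rfl

lemma snd_pow (x : CocycleExt α) (n : ℕ) : (x ^ n).snd = x.snd ^ n := map_pow (proj α) x n

lemma incl_injective : Function.Injective (incl α) := fun _ _ h => congrArg fst h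

lemma incl_commute (u : ℂˣ) (x : CocycleExt α) : Commute (incl α u) x := by
  ext1 <;> simp [cocycle_one_left, cocycle_one_right, mul_comm]

lemma eq_incl {x : CocycleExt α} (h : x.snd = 1) : x = incl α x.fst := by
  ext1 <;> simp [h]

end CocycleExt

section Commutator

variable {G : Type*} [Group G]

/-- The pairing `α ↦ α(g,h) / α(h,g)`; for commuting `g` and `h` it is the commutator of
lifts of `g` and `h` to the central extension attached to `α`. -/
def commutatorPairing (g h : G) : mul2Cocycles G →* ℂˣ where
  toFun α := α.1 (g, h) / α.1 (h, g)
  map_one' := by simp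
  map_mul' α β := by simp [mul_div_mul_comm]

lemma commutatorPairing_apply (g h : G) (α : mul2Cocycles G) :
    commutatorPairing g h α = α.1 (g, h) / α.1 (h, g) := rfl

lemma commutatorPairing_of_isMul2Coboundary {g h : G} (hgh : Commute g h) {α : mul2Cocycles G}
    (hα : IsMul2Coboundary α.1) : commutatorPairing g h α = 1 := by
  obtain ⟨f, -, hf⟩ := hα
  rw [commutatorPairing_apply, hf, hf, hgh.eq, mul_comm (f g), div_self']

lemma CocycleExt.mul_eq_incl_commutatorPairing_mul {α : mul2Cocycles G} (x y : CocycleExt α)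
    (h : Commute x.snd y.snd) :
    x * y = incl α (commutatorPairing x.snd y.snd α) * (y * x) := by
  ext1
  · rw [mul_fst, mul_fst, mul_fst, incl_fst, incl_snd, cocycle_one_left, mul_one,
      commutatorPairing_apply, mul_comm y.fst, mul_left_comm, div_mul_cancel]
  · simpa using h.eq

lemma commutatorPairing_pow_eq_one {g h : G} (hgh : Commute g h) {n : ℕ} (hg : g ^ n = 1)
    (α : mul2Cocycles G) : commutatorPairing g h α ^ n = 1 := by
  set x : CocycleExt α := ⟨1, g⟩ with hx
  set z : CocycleExt α := ⟨1, h⟩ with hz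
  set l := commutatorPairing g h α
  have hxz : x * z = CocycleExt.incl α l * (z * x) :=
    CocycleExt.mul_eq_incl_commutatorPairing_mul x z hgh
  have hxn : x ^ n = CocycleExt.incl α (x ^ n).fst :=
    CocycleExt.eq_incl (by rw [CocycleExt.snd_pow, hx, hg])
  have hconj : SemiconjBy z (CocycleExt.incl α l * x) x := by
    rw [SemiconjBy, hxz, ← mul_assoc, ← mul_assoc, (CocycleExt.incl_commute l z).eq]
  have h1 := hconj.pow_right n
  rw [(CocycleExt.incl_commute l x).mul_pow, hxn, SemiconjBy,
    (CocycleExt.incl_commute _ z).eq, mul_right_inj] at h1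
  apply CocycleExt.incl_injective (α := α)
  rw [map_pow, map_one]
  exact mul_eq_right.mp h1

/-- An element of order dividing `n` lifts to one of order dividing `n`, since `ℂˣ` is
divisible. -/
lemma CocycleExt.exists_lift_pow_eq_one (α : mul2Cocycles G)
    {n : ℕ} [NeZero n] {g : G} (hg : g ^ n = 1) :
    ∃ x : CocycleExt α, x.snd = g ∧ x ^ n = 1 := by
  set x : CocycleExt α := ⟨1, g⟩ with hx
  have hxn : x ^ n = CocycleExt.incl α (x ^ n).fst :=
    CocycleExt.eq_incl (by rw [CocycleExt.snd_pow, hx, hg])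
  obtain ⟨t, ht⟩ := IsAlgClosed.exists_pow_nat_eq (((x ^ n).fst⁻¹ : ℂˣ) : ℂ) (NeZero.pos n)
  have ht0 : t ≠ 0 := by
    rintro rfl
    rw [zero_pow (NeZero.ne n)] at ht
    exact Units.ne_zero _ ht.symm
  have htn : (Units.mk0 t ht0) ^ n = (x ^ n).fst⁻¹ := Units.ext (by simpa using ht)
  refine ⟨CocycleExt.incl α (Units.mk0 t ht0) * x, by simp [hx], ?_⟩
  rw [(CocycleExt.incl_commute _ x).mul_pow, ← map_pow, htn, map_inv, inv_mul_eq_one]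
  exact hxn.symm

end Commutator

namespace Heisenberg

section Presentation

variable {n : ℕ} {E : Type*} [Group E] {x y w : E}

lemma pow_mul_pow_eq (hw : x * y = y * (x * w)) (hwx : Commute w x) (hwy : Commute w y)
    (a b : ℕ) : x ^ b * y ^ a = y ^ a * x ^ b * w ^ (b * a) := by
  have h : ∀ a : ℕ, SemiconjBy (y ^ a) (x * w ^ a) x := by
    intro a
    induction a with
    | zero => simp [SemiconjBy]
    | succ a ih =>
      calc y ^ (a + 1) * (x * w ^ (a + 1))
          = y ^ a * (y * (x * w)) * w ^ a := by
            rw [pow_succ, pow_succ']; simp only [mul_assoc]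
        _ = y ^ a * (x * (y * w ^ a)) := by rw [← hw]; simp only [mul_assoc]
        _ = y ^ a * (x * w ^ a) * y := by
            rw [← (hwy.pow_left a).eq]; simp only [mul_assoc]
        _ = x * y ^ (a + 1) := by rw [(ih : _ = _), mul_assoc, pow_succ]
  have := (h a).pow_right b
  rw [(hwx.symm.pow_right a).mul_pow, ← pow_mul, SemiconjBy] at this
  rw [← this, mul_assoc, mul_comm b a]

lemma pow_val_natCast (hx : x ^ n = 1) (k : ℕ) : x ^ (k : ZMod n).val = x ^ k := by
  rw [ZMod.val_natCast, ← pow_eq_pow_mod k hx]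

variable [NeZero n]

lemma pow_val_add (hx : x ^ n = 1) (a b : ZMod n) :
    x ^ (a + b).val = x ^ a.val * x ^ b.val := by
  rw [← pow_add, ← pow_val_natCast hx (a.val + b.val)]
  simp

lemma pow_val_mul (hx : x ^ n = 1) (a b : ZMod n) : x ^ (a * b).val = x ^ (a.val * b.val) := by
  rw [← pow_val_natCast hx (a.val * b.val)]
  simp

/-- The homomorphism from the Heisenberg group over `ℤ/nℤ` determined by the images of its
standard generators. -/
def lift (hx : x ^ n = 1) (hy : y ^ n = 1) (hw : x * y = y * (x * w)) (hwx : Commute w x)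
    (hwy : Commute w y) : Heisenberg (ZMod n) →* E :=
  have hwn : w ^ n = 1 := by
    have h := SemiconjBy.pow_right (show SemiconjBy y (x * w) x from hw.symm) n
    rw [hwx.symm.mul_pow, hx, one_mul, SemiconjBy, one_mul] at h
    exact mul_eq_left.mp h
  MonoidHom.mk' (fun g => y ^ g.a.val * x ^ g.b.val * w ^ g.c.val) fun g h => by
    have e := pow_mul_pow_eq hw hwx hwy h.a.val g.b.val
    rw [mul_a, mul_b, mul_c, pow_val_add hx, pow_val_add hy, pow_val_add hwn,
      pow_val_add hwn, pow_val_mul hwn]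
    have c1 : Commute (w ^ g.c.val) (y ^ h.a.val * x ^ h.b.val) :=
      (hwy.pow_pow _ _).mul_right (hwx.pow_pow _ _)
    have c2 : Commute (w ^ (g.b.val * h.a.val)) (x ^ h.b.val) := hwx.pow_pow _ _
    have c3 : Commute (w ^ (g.b.val * h.a.val)) (w ^ g.c.val * w ^ h.c.val) :=
      ((Commute.refl w).pow_pow _ _).mul_right ((Commute.refl w).pow_pow _ _)
    symm
    calc y ^ g.a.val * x ^ g.b.val * w ^ g.c.val * (y ^ h.a.val * x ^ h.b.val * w ^ h.c.val)
        = y ^ g.a.val * x ^ g.b.val * (w ^ g.c.val * (y ^ h.a.val * x ^ h.b.val)) *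
            w ^ h.c.val := by simp only [mul_assoc]
      _ = y ^ g.a.val * (x ^ g.b.val * y ^ h.a.val) * x ^ h.b.val *
            (w ^ g.c.val * w ^ h.c.val) := by rw [c1.eq]; simp only [mul_assoc]
      _ = y ^ g.a.val * y ^ h.a.val * x ^ g.b.val *
            (w ^ (g.b.val * h.a.val) * x ^ h.b.val) * (w ^ g.c.val * w ^ h.c.val) := by
          rw [e]; simp only [mul_assoc]
      _ = y ^ g.a.val * y ^ h.a.val * (x ^ g.b.val * x ^ h.b.val) *
            (w ^ (g.b.val * h.a.val) * (w ^ g.c.val * w ^ h.c.val)) := by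
          rw [c2.eq]; simp only [mul_assoc]
      _ = _ := by rw [c3.eq]

lemma lift_apply (hx : x ^ n = 1) (hy : y ^ n = 1) (hw : x * y = y * (x * w))
    (hwx : Commute w x) (hwy : Commute w y) (g : Heisenberg (ZMod n)) :
    lift hx hy hw hwx hwy g = y ^ g.a.val * x ^ g.b.val * w ^ g.c.val := rfl

end Presentation

section Generators

variable (R : Type*) [CommRing R]

/-- The generator of `H₃(R)` with (1,2)-entry `1`. -/
def genX : Heisenberg R := ⟨0, 1, 0⟩

/-- The generator of `H₃(R)` with (2,3)-entry `1`. -/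
def genY : Heisenberg R := ⟨1, 0, 0⟩

/-- The central element of `H₃(R)` with (1,3)-entry `1`. -/
def genZ : Heisenberg R := ⟨0, 0, 1⟩

lemma genZ_commute (g : Heisenberg R) : Commute (genZ R) g := by
  ext <;> simp [genZ, add_comm]

lemma genX_mul_genY : genX R * genY R = genY R * (genX R * genZ R) := by
  ext <;> simp [genX, genY, genZ]

lemma genX_pow (k : ℕ) : genX R ^ k = ⟨0, k, 0⟩ := by
  induction k with
  | zero => ext <;> simp
  | succ k ih => rw [pow_succ, ih]; ext <;> simp [genX]

lemma genY_pow (k : ℕ) : genY R ^ k = ⟨k, 0, 0⟩ := by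
  induction k with
  | zero => ext <;> simp
  | succ k ih => rw [pow_succ, ih]; ext <;> simp [genY]

lemma genZ_pow (k : ℕ) : genZ R ^ k = ⟨0, 0, k⟩ := by
  induction k with
  | zero => ext <;> simp
  | succ k ih => rw [pow_succ, ih]; ext <;> simp [genZ]

lemma genX_pow_char (n : ℕ) [CharP R n] : genX R ^ n = 1 := by
  rw [genX_pow, CharP.cast_eq_zero]; rfl

lemma genY_pow_char (n : ℕ) [CharP R n] : genY R ^ n = 1 := by
  rw [genY_pow, CharP.cast_eq_zero]; rfl

end Generators

/-- A cocycle on `H₃(ℤ/nℤ)` whose commutator pairings of the standard generators with the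
centre vanish is a coboundary. -/
lemma isMul2Coboundary_of_commutatorPairing {n : ℕ} [NeZero n]
    (α : mul2Cocycles (Heisenberg (ZMod n)))
    (hX : commutatorPairing (genX _) (genZ _) α = 1)
    (hY : commutatorPairing (genY _) (genZ _) α = 1) : IsMul2Coboundary α.1 := by
  obtain ⟨x, hxX, hx⟩ := CocycleExt.exists_lift_pow_eq_one α (genX_pow_char (ZMod n) n)
  obtain ⟨y, hyY, hy⟩ := CocycleExt.exists_lift_pow_eq_one α (genY_pow_char (ZMod n) n)
  obtain ⟨w, hw⟩ : ∃ w, x * y = y * (x * w) := ⟨x⁻¹ * (y⁻¹ * (x * y)), by simp⟩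
  have hwZ : w.snd = genZ (ZMod n) := by
    have h := congrArg CocycleExt.snd hw
    simp only [CocycleExt.mul_snd, hxX, hyY, genX_mul_genY] at h
    exact (mul_left_cancel (mul_left_cancel h)).symm
  have hwx : Commute w x := by
    have h := CocycleExt.mul_eq_incl_commutatorPairing_mul x w
      (by rw [hwZ]; exact (genZ_commute _ _).symm)
    rw [hxX, hwZ, hX, map_one, one_mul] at h
    exact h.symm
  have hwy : Commute w y := by
    have h := CocycleExt.mul_eq_incl_commutatorPairing_mul y w
      (by rw [hwZ]; exact (genZ_commute _ _).symm)
    rw [hyY, hwZ, hY, map_one, one_mul] at h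
    exact h.symm
  set s := lift hx hy hw hwx hwy with hs
  have hsnd : ∀ g, (s g).snd = g := by
    intro g
    rw [hs, lift_apply, CocycleExt.mul_snd, CocycleExt.mul_snd, CocycleExt.snd_pow,
      CocycleExt.snd_pow, CocycleExt.snd_pow, hxX, hyY, hwZ, genX_pow, genY_pow, genZ_pow]
    ext <;> simp
  refine ⟨fun g => (s g).fst⁻¹, by simp, fun g h => ?_⟩
  beta_reduce
  rw [map_mul, CocycleExt.mul_fst, hsnd, hsnd, inv_inv, ← mul_inv, inv_mul_cancel_left]

section Construction

variable {R : Type*} [CommRing R] [Invertible (2 : R)]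

/-- For an additive character `χ` with values in `ℂˣ`, the cocycles on `H₃(R)` obtained from
the unipotent `4 × 4` matrices with superdiagonals `(b, b, a)` and `(b, a, a)`. -/
def cocycleHom (χ : Multiplicative R →* ℂˣ) :
    Multiplicative (Fin 2 → R) →* mul2Cocycles (Heisenberg R) where
  toFun v := ⟨fun q => χ (.ofAdd
      (v.toAdd 0 * (q.1.b * q.2.c + ⅟2 * q.1.b ^ 2 * q.2.a) +
        v.toAdd 1 * (⅟2 * q.1.b * q.2.a ^ 2 + q.1.c * q.2.a))), by
    refine ⟨by simp, fun x y z => ?_⟩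
    beta_reduce
    rw [← map_mul χ, ← map_mul χ, ← ofAdd_add, ← ofAdd_add]
    congr 2
    have h2 : (⅟2 : R) * 2 = 1 := invOf_mul_self 2
    simp only [mul_a, mul_b, mul_c]
    linear_combination
      (v.toAdd 0 * x.b * y.b * z.a - v.toAdd 1 * x.b * y.a * z.a) * h2⟩
  map_one' := by
    ext
    simp
  map_mul' v w := by
    apply Subtype.ext
    funext q
    simp only [Subgroup.coe_mul, Pi.mul_apply, ← map_mul, ← ofAdd_add]
    congr 2
    simp only [toAdd_mul, Pi.add_apply]
    ring

lemma commutatorPairing_genX_cocycleHom (χ : Multiplicative R →* ℂˣ)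
    (v : Multiplicative (Fin 2 → R)) :
    commutatorPairing (genX R) (genZ R) (cocycleHom χ v) = χ (.ofAdd (v.toAdd 0)) := by
  simp [commutatorPairing_apply, cocycleHom, genX, genZ]

lemma commutatorPairing_genY_cocycleHom (χ : Multiplicative R →* ℂˣ)
    (v : Multiplicative (Fin 2 → R)) :
    commutatorPairing (genY R) (genZ R) (cocycleHom χ v) = (χ (.ofAdd (v.toAdd 1)))⁻¹ := by
  simp [commutatorPairing_apply, cocycleHom, genY, genZ]

end Construction

end Heisenberg

/-- A faithful character of `ℤ/nℤ` whose values are all the `n`-th roots of unity. -/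
lemma exists_injective_character (n : ℕ) [NeZero n] :
    ∃ χ : Multiplicative (ZMod n) →* ℂˣ, Function.Injective χ ∧
      ∀ u : ℂˣ, u ^ n = 1 → ∃ k : ZMod n, χ (.ofAdd k) = u := by
  obtain ⟨ζ, hζ⟩ : ∃ ζ : ℂˣ, IsPrimitiveRoot ζ n :=
    ⟨_, ((Complex.isPrimitiveRoot_exp n (NeZero.ne n)).isUnit_unit (NeZero.ne n))⟩
  refine ⟨(Subgroup.zpowers ζ).subtype.comp
    (AddMonoidHom.toMultiplicativeLeft hζ.zmodEquivZPowers.toAddMonoidHom), ?_, ?_⟩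
  · exact Subtype.val_injective.comp hζ.zmodEquivZPowers.injective
  · intro u hu
    have hmem : u ∈ Subgroup.zpowers ζ := by
      rw [hζ.zpowers_eq]; exact hu
    refine ⟨hζ.zmodEquivZPowers.symm (.ofMul ⟨u, hmem⟩), ?_⟩
    exact congrArg (fun t => (t.toMul : ℂˣ))
      (hζ.zmodEquivZPowers.apply_symm_apply (.ofMul ⟨u, hmem⟩))

open Heisenberg in
/-- The Schur multiplier of the Heisenberg group over `ℤ/nℤ` for odd `n`. -/
lemma schurMultiplier_heisenberg_zmod_of_odd (n : ℕ) (hn : Odd n) :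
    Nonempty (SchurMultiplier (Heisenberg (ZMod n)) ≃* Multiplicative (Fin 2 → ZMod n)) := by
  have : NeZero n := ⟨hn.pos.ne'⟩
  have h2 : IsUnit (2 : ZMod n) := by
    simpa using (ZMod.isUnit_iff_coprime 2 n).mpr hn.coprime_two_left
  let _ := h2.invertible
  obtain ⟨χ, hinj, hsurj⟩ := exists_injective_character n
  set Ψ : Multiplicative (Fin 2 → ZMod n) →* SchurMultiplier (Heisenberg (ZMod n)) :=
    (QuotientGroup.mk' _).comp (cocycleHom χ) with hΨ
  suffices h : Function.Bijective Ψ from ⟨(MulEquiv.ofBijective Ψ h).symm⟩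
  constructor
  · rw [injective_iff_map_eq_one]
    intro v hv
    have hb : IsMul2Coboundary (cocycleHom χ v).1 :=
      Subgroup.mem_subgroupOf.mp ((QuotientGroup.eq_one_iff _).mp hv)
    have h0 := commutatorPairing_of_isMul2Coboundary (genZ_commute _ (genX _)).symm hb
    have h1 := commutatorPairing_of_isMul2Coboundary (genZ_commute _ (genY _)).symm hb
    rw [commutatorPairing_genX_cocycleHom, ← map_one χ] at h0
    rw [commutatorPairing_genY_cocycleHom, inv_eq_one, ← map_one χ] at h1
    apply Multiplicative.toAdd.injective
    funext i
    fin_cases i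
    · exact congrArg Multiplicative.toAdd (hinj h0)
    · exact congrArg Multiplicative.toAdd (hinj h1)
  · intro q
    obtain ⟨α, rfl⟩ := QuotientGroup.mk_surjective q
    obtain ⟨k, hk⟩ := hsurj _
      (commutatorPairing_pow_eq_one (genZ_commute _ (genX _)).symm (genX_pow_char _ n) α)
    obtain ⟨l, hl⟩ := hsurj _
      (commutatorPairing_pow_eq_one (genZ_commute _ (genY _)).symm (genY_pow_char _ n) α)
    refine ⟨.ofAdd ![k, -l], QuotientGroup.eq.mpr (Subgroup.mem_subgroupOf.mpr ?_)⟩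
    apply isMul2Coboundary_of_commutatorPairing
    · rw [map_mul, map_inv, commutatorPairing_genX_cocycleHom, ← hk]
      simp
    · rw [map_mul, map_inv, commutatorPairing_genY_cocycleHom, ← hl]
      simp

/-- The Schur multiplier of the Heisenberg group over `ℤ/p²ℤ`, for `p` an odd prime, is
isomorphic as an abelian group to `(ℤ/p²ℤ)²`. -/
theorem schurMultiplier_heisenberg_zmod_p_sq (p : ℕ) [Fact p.Prime] (hodd : Odd p) :
    Nonempty
      (SchurMultiplier (Heisenberg (ZMod (p ^ 2))) ≃*
        Multiplicative (Fin 2 → ZMod (p ^ 2))) := by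
  exact schurMultiplier_heisenberg_zmod_of_odd (p ^ 2) hodd.pow
end

section
/- Let p be an odd prime and let G be a finite p-group of nilpotency class 2 and of exponent p (i.e. gᵖ = 1 for all g ∈ G). Then the Schur multiplier H²(G, ℂˣ) is an elementary abelian p-group; that is, every element of H²(G, ℂˣ) has order dividing p. -/
section CentralPowers

open scoped commutatorElement IsMulCommutative

variable {H : Type*} [Group H]

theorem Odd.dvd_choose_two {n : ℕ} (hn : Odd n) : n ∣ n.choose 2 := by
  obtain ⟨k, rfl⟩ := hn
  refine ⟨k, ?_⟩
  rw [Nat.choose_two_right, Nat.add_sub_cancel, mul_left_comm,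
    Nat.mul_div_cancel_left _ two_pos]

/-- If all commutators `⁅c, w⁆` are central, then `c` commutes with the commutator subgroup. -/
theorem commute_of_mem_commutator {c : H} (hc : ∀ w, ⁅c, w⁆ ∈ Subgroup.center H) {d : H}
    (hd : d ∈ commutator H) : Commute c d := by
  let φ : H →* Subgroup.center H := MonoidHom.mk' (fun w => ⟨⁅c, w⁆, hc w⟩) fun a b => by
    ext
    have hb := Subgroup.mem_center_iff.mp (hc b) a
    calc ⁅c, a * b⁆ = ⁅c, a⁆ * (a * ⁅c, b⁆ * a⁻¹) := by
          simp only [commutatorElement_def]; group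
      _ = ⁅c, a⁆ * ⁅c, b⁆ := by rw [hb, mul_inv_cancel_right]
  have h : φ d = 1 := Abelianization.commutator_subset_ker φ hd
  exact commutatorElement_eq_one_iff_commute.mp (congrArg Subtype.val h)

theorem pow_mul_of_mul_eq {x c z : H} (hz : z ∈ Subgroup.center H) (h : x * c = z * (c * x))
    (n : ℕ) : x ^ n * c = z ^ n * (c * x ^ n) := by
  have hz' := Subgroup.mem_center_iff.mp hz
  induction n with
  | zero => simp
  | succ n ih =>
    calc x ^ (n + 1) * c = x ^ n * (x * c) := by rw [pow_succ, mul_assoc]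
      _ = x ^ n * z * (c * x) := by rw [h, mul_assoc]
      _ = z * (x ^ n * c) * x := by rw [hz']; simp only [mul_assoc]
      _ = z ^ (n + 1) * (c * x ^ (n + 1)) := by
        rw [ih, pow_succ', pow_succ x]; simp only [mul_assoc]

theorem mul_pow_of_mul_eq {x c z : H} (hz : z ∈ Subgroup.center H) (h : x * c = z * (c * x))
    (n : ℕ) : (c * x) ^ n = z ^ n.choose 2 * (c ^ n * x ^ n) := by
  induction n with
  | zero => simp
  | succ n ih =>
    have hz' := Subgroup.mem_center_iff.mp (pow_mem hz n) (c ^ n)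
    calc (c * x) ^ (n + 1) = z ^ n.choose 2 * (c ^ n * (x ^ n * c) * x) := by
          rw [pow_succ, ih]; simp only [mul_assoc]
      _ = z ^ n.choose 2 * (c ^ n * z ^ n * (c * x ^ n * x)) := by
          rw [pow_mul_of_mul_eq hz h]; simp only [mul_assoc]
      _ = z ^ (n + 1).choose 2 * (c ^ (n + 1) * x ^ (n + 1)) := by
          rw [hz', Nat.choose_succ_succ' n 1, Nat.choose_one_right, add_comm n, pow_add,
            pow_succ c, pow_succ x]
          simp only [mul_assoc]

/-- In a group of class at most `3` in which `n`-th powers are central, `n` odd, every commutator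
has trivial `n`-th power. -/
theorem commutatorElement_pow_eq_one {n : ℕ} (hn : Odd n)
    (hpow : ∀ g : H, g ^ n ∈ Subgroup.center H)
    (hclass : ∀ x y w : H, ⁅⁅x, y⁆, w⁆ ∈ Subgroup.center H) (y x : H) : ⁅y, x⁆ ^ n = 1 := by
  set c := ⁅y, x⁆ with hc
  set z := ⁅x, c⁆ with hz
  have hzc : z ∈ Subgroup.center H := by
    rw [hz, ← commutatorElement_inv]
    exact inv_mem (hclass y x x)
  have hxc : x * c = z * (c * x) := by rw [hz, commutatorElement_def]; group
  have hzn : z ^ n = 1 := by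
    have h := pow_mul_of_mul_eq hzc hxc n
    rw [Subgroup.mem_center_iff.mp (hpow x) c] at h
    exact right_eq_mul.mp h
  have hcx : c * x = y * x * y⁻¹ := by rw [hc, commutatorElement_def]; group
  obtain ⟨k, hk⟩ := hn.dvd_choose_two
  have h := mul_pow_of_mul_eq hzc hxc n
  rw [hk, pow_mul, hzn, one_pow, one_mul, hcx, conj_pow,
    Subgroup.mem_center_iff.mp (hpow x) y, mul_inv_cancel_right] at h
  exact right_eq_mul.mp h

/-- In a group of class at most `3` in which `n`-th powers are central, `n` odd, the commutator
subgroup has exponent dividing `n`. -/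
theorem pow_eq_one_of_mem_commutator {n : ℕ} (hn : Odd n)
    (hpow : ∀ g : H, g ^ n ∈ Subgroup.center H)
    (hclass : ∀ x y w : H, ⁅⁅x, y⁆, w⁆ ∈ Subgroup.center H) {d : H} (hd : d ∈ commutator H) :
    d ^ n = 1 := by
  rw [commutator_eq_closure] at hd
  induction hd using Subgroup.closure_induction_left with
  | one => exact one_pow n
  | mul_left a ha b hb ih =>
    obtain ⟨y, x, rfl⟩ := ha
    rw [← commutator_eq_closure] at hb
    rw [(commute_of_mem_commutator (hclass y x) hb).mul_pow,
      commutatorElement_pow_eq_one hn hpow hclass, ih, one_mul]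
  | inv_mul_cancel a ha b hb ih =>
    obtain ⟨y, x, rfl⟩ := ha
    rw [← commutator_eq_closure] at hb
    rw [(commute_of_mem_commutator (hclass y x) hb).inv_left.mul_pow, inv_pow,
      commutatorElement_pow_eq_one hn hpow hclass, ih, inv_one, one_mul]

end CentralPowers

section Extension

open scoped commutatorElement

/-- Characters with values in `ℂˣ` extend along injections of commutative groups. -/
theorem exists_extension_units_complex {M N : Type*} [CommGroup M] [CommGroup N] (f : M →* N)
    (hf : Function.Injective f) (g : M →* ℂˣ) : ∃ h : N →* ℂˣ, h.comp f = g := by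
  have hroot : ∀ {n : ℤ}, n ≠ 0 → Function.Surjective fun a : Additive ℂˣ => n • a := by
    intro n hn a
    have hpos : 0 < n.natAbs := Int.natAbs_pos.mpr hn
    obtain ⟨w, hw⟩ := IsAlgClosed.exists_pow_nat_eq (a.toMul : ℂ) hpos
    have hw0 : w ≠ 0 := by
      rintro rfl
      rw [zero_pow hpos.ne'] at hw
      exact a.toMul.ne_zero hw.symm
    have hu : (Units.mk0 w hw0) ^ n.natAbs = a.toMul := Units.ext hw
    obtain h | h := Int.natAbs_eq n
    · refine ⟨Additive.ofMul (Units.mk0 w hw0), ?_⟩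
      rw [h]
      exact congrArg Additive.ofMul ((zpow_natCast _ _).trans hu)
    · refine ⟨Additive.ofMul (Units.mk0 w hw0)⁻¹, ?_⟩
      rw [h]
      refine congrArg Additive.ofMul (?_ : (Units.mk0 w hw0)⁻¹ ^ (-(n.natAbs : ℤ)) = a.toMul)
      rw [zpow_neg, inv_zpow, inv_inv, zpow_natCast, hu]
  let : DivisibleBy (Additive ℂˣ) ℤ := divisibleByOfSMulRightSurj _ _ hroot
  obtain ⟨h, hh⟩ := (Module.Baer.of_divisible (Additive ℂˣ)).extension_property_addMonoidHom
    (MonoidHom.toAdditive f) hf (MonoidHom.toAdditive g)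
  exact ⟨MonoidHom.toAdditive.symm h, MonoidHom.ext fun x =>
    congrArg Additive.toMul (DFunLike.congr_fun hh (Additive.ofMul x))⟩

/-- If `ι : ℂˣ → H` and `(ι a) ^ n = 1` implies `a ^ n = 1` whenever `ι a` is a product of
commutators, then the `n`-th power map extends along `ι` to a character of `H`. -/
theorem exists_hom_apply_eq_pow {H : Type*} [Group H] (ι : ℂˣ →* H) (n : ℕ)
    (h : ∀ a, ι a ∈ commutator H → a ^ n = 1) : ∃ χ : H →* ℂˣ, ∀ a, χ (ι a) = a ^ n := by
  let φ : ℂˣ →* Abelianization H := Abelianization.of.comp ι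
  have hφ : φ.ker ≤ (powMonoidHom n : ℂˣ →* ℂˣ).ker := fun a ha => by
    refine h a ?_
    rw [← Abelianization.ker_of]
    exact ha
  obtain ⟨ψ, hψ⟩ := exists_extension_units_complex (M := ℂˣ ⧸ φ.ker) (QuotientGroup.kerLift φ)
    (QuotientGroup.kerLift_injective φ) (QuotientGroup.lift φ.ker (powMonoidHom n) hφ)
  exact ⟨ψ.comp Abelianization.of, fun a => DFunLike.congr_fun hψ (a : ℂˣ ⧸ φ.ker)⟩

variable {G : Type*} [Group G]

/-- The underlying type of the central extension of `G` by `ℂˣ` defined by a `2`-cocycle. -/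
@[ext]
structure CocycleExtension (α : mul2Cocycles G) where
  /-- The coordinate in `ℂˣ`. -/
  scalar : ℂˣ
  /-- The projection to `G`. -/
  proj : G

namespace CocycleExtension

variable (α : mul2Cocycles G)

theorem cocycle_eq (x y z : G) :
    α.1 (x, y) * α.1 (x * y, z) = α.1 (x, y * z) * α.1 (y, z) :=
  α.2.2 x y z

theorem cocycle_one_left (x : G) : α.1 (1, x) = 1 := by
  have h := cocycle_eq α 1 1 x
  rw [one_mul, one_mul, α.2.1, one_mul] at h
  exact right_eq_mul.mp h

theorem cocycle_one_right (x : G) : α.1 (x, 1) = 1 := by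
  have h := cocycle_eq α x 1 1
  rw [mul_one, mul_one, α.2.1, mul_one] at h
  exact mul_eq_left.mp h

instance : Mul (CocycleExtension α) :=
  ⟨fun u v => ⟨u.scalar * v.scalar * α.1 (u.proj, v.proj), u.proj * v.proj⟩⟩

instance : One (CocycleExtension α) := ⟨⟨1, 1⟩⟩

instance : Inv (CocycleExtension α) :=
  ⟨fun u => ⟨u.scalar⁻¹ * (α.1 (u.proj⁻¹, u.proj))⁻¹, u.proj⁻¹⟩⟩

variable {α}

@[simp] theorem scalar_mul (u v : CocycleExtension α) :
    (u * v).scalar = u.scalar * v.scalar * α.1 (u.proj, v.proj) := rfl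

@[simp] theorem proj_mul (u v : CocycleExtension α) : (u * v).proj = u.proj * v.proj := rfl

@[simp] theorem scalar_one : (1 : CocycleExtension α).scalar = 1 := rfl

@[simp] theorem proj_one : (1 : CocycleExtension α).proj = 1 := rfl

@[simp] theorem scalar_inv (u : CocycleExtension α) :
    u⁻¹.scalar = u.scalar⁻¹ * (α.1 (u.proj⁻¹, u.proj))⁻¹ := rfl

@[simp] theorem proj_inv (u : CocycleExtension α) : u⁻¹.proj = u.proj⁻¹ := rfl

instance : Group (CocycleExtension α) :=
  Group.ofLeftAxioms
    (fun u v w => by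
      ext1
      · simp only [scalar_mul, proj_mul]
        calc u.scalar * v.scalar * α.1 (u.proj, v.proj) * w.scalar * α.1 (u.proj * v.proj, w.proj)
            = u.scalar * v.scalar * w.scalar *
              (α.1 (u.proj, v.proj) * α.1 (u.proj * v.proj, w.proj)) := by
              simp only [mul_assoc, mul_left_comm, mul_comm]
          _ = _ := by
              rw [cocycle_eq]; simp only [mul_assoc, mul_left_comm, mul_comm]
      · exact mul_assoc _ _ _)
    (fun u => by ext1 <;> simp [cocycle_one_left])
    (fun u => by
      ext1
      · simp only [scalar_mul, scalar_inv, proj_inv, scalar_one]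
        rw [mul_right_comm u.scalar⁻¹, inv_mul_cancel, one_mul, inv_mul_cancel]
      · exact inv_mul_cancel _)

variable (α)

/-- The projection of the central extension onto `G`. -/
def projHom : CocycleExtension α →* G where
  toFun := proj
  map_one' := rfl
  map_mul' _ _ := rfl

/-- The inclusion of `ℂˣ` into the central extension. -/
def incl : ℂˣ →* CocycleExtension α where
  toFun a := ⟨a, 1⟩
  map_one' := rfl
  map_mul' a b := by ext1 <;> simp [cocycle_one_left]

variable {α}

theorem mem_center_of_proj_eq_one {u : CocycleExtension α} (hu : u.proj = 1) :
    u ∈ Subgroup.center (CocycleExtension α) := by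
  rw [Subgroup.mem_center_iff]
  intro v
  ext1 <;> simp [hu, cocycle_one_left, cocycle_one_right, mul_comm]

theorem pow_mem_center {u : CocycleExtension α} {n : ℕ} (hu : u.proj ^ n = 1) :
    u ^ n ∈ Subgroup.center (CocycleExtension α) :=
  mem_center_of_proj_eq_one ((map_pow (projHom α) u n).trans hu)

theorem commutatorElement_mem_center (hG : commutator G ≤ Subgroup.center G)
    (u v w : CocycleExtension α) : ⁅⁅u, v⁆, w⁆ ∈ Subgroup.center (CocycleExtension α) := by
  refine mem_center_of_proj_eq_one (?_ : projHom α ⁅⁅u, v⁆, w⁆ = 1)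
  rw [map_commutatorElement, map_commutatorElement, commutatorElement_eq_one_iff_mul_comm]
  exact (Subgroup.mem_center_iff.mp (hG (Subgroup.commutator_mem_commutator
    (Subgroup.mem_top _) (Subgroup.mem_top _))) _).symm

end CocycleExtension

/-- A character of the central extension restricting to the `n`-th power map on `ℂˣ` trivializes
the `n`-th power of the cocycle. -/
theorem pow_mem_mul2Coboundaries (α : mul2Cocycles G) {n : ℕ} (χ : CocycleExtension α →* ℂˣ)
    (hχ : ∀ a, χ (CocycleExtension.incl α a) = a ^ n) : α.1 ^ n ∈ mul2Coboundaries G := by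
  refine ⟨fun x => χ ⟨1, x⟩, map_one χ, fun x y => ?_⟩
  have h : (⟨1, x⟩ * ⟨1, y⟩ : CocycleExtension α) =
      CocycleExtension.incl α (α.1 (x, y)) * ⟨1, x * y⟩ := by
    ext1 <;> simp [CocycleExtension.incl, CocycleExtension.cocycle_one_left]
  rw [eq_mul_inv_iff_mul_eq, ← map_mul, h, map_mul, hχ, Pi.pow_apply]

end Extension

/-- For an odd prime `p` and a finite `p`-group `G` of nilpotency class `2` (the
commutator subgroup is nontrivial and central) and exponent `p`, the Schur multiplier
`H²(G, ℂˣ)` is an elementary abelian `p`-group: every element has order dividing `p`. -/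
theorem schurMultiplier_elementary_abelian {p : ℕ} (hp : p.Prime) (hodd : Odd p)
    (G : Type*) [Group G] [Finite G] (hpG : IsPGroup p G)
    (hcomm_le : commutator G ≤ Subgroup.center G) (hcomm_ne : commutator G ≠ ⊥)
    (hexp : ∀ g : G, g ^ p = 1) :
    ∀ x : SchurMultiplier G, x ^ p = 1 := by
  intro x
  induction x using QuotientGroup.induction_on with
  | H α =>
    rw [← QuotientGroup.mk_pow, QuotientGroup.eq_one_iff, Subgroup.mem_subgroupOf]
    obtain ⟨χ, hχ⟩ := exists_hom_apply_eq_pow (CocycleExtension.incl α) p fun a ha => by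
      have h := pow_eq_one_of_mem_commutator hodd
        (fun u => CocycleExtension.pow_mem_center (hexp u.proj))
        (CocycleExtension.commutatorElement_mem_center hcomm_le) ha
      rw [← map_pow] at h
      exact congrArg CocycleExtension.scalar h
    exact pow_mem_mul2Coboundaries α χ hχ
end
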